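/- For every integer n ≥ 1 there exists a bijection φ from S_{n-1} × {0, 1, ..., n-1} onto S_n such that for every π ∈ S_{n-1} and every c with 0 ≤ c ≤ n-1: exc(φ(π,c)) = exc(π) if 0 ≤ c ≤ exc(π), and exc(φ(π,c)) = exc(π) + 1 otherwise; and den(φ(π,c)) = den(π) + c. -/

import Mathlib

open Finset

/-- The value of the permutation `π ∈ S_n` at the (1-based) position `i`,
in one-line notation with letters `1,…,n`; `0` if `i` is out of range. -/
def pval {n : ℕ} (π : Equiv.Perm (Fin n)) (i : ℕ) : ℕ :=
  if h : 1 ≤ i ∧ i ≤ n then ((π ⟨i - 1, by omega⟩ : Fin n) : ℕ) + 1 else 0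

/-- The number of inversions of a word `w`, i.e. pairs of positions `i < j`
with `w_i > w_j`. -/
def winv (w : List ℕ) : ℕ :=
  ((Finset.range w.length ×ˢ Finset.range w.length).filter
    (fun p => p.1 < p.2 ∧ w.getD p.2 0 < w.getD p.1 0)).card

/-- `rDes(π) = {i ∈ [n-1] : π_i ≥ π_{i+1} + r}`. -/
def rDesSet {n : ℕ} (r : ℕ) (π : Equiv.Perm (Fin n)) : Finset ℕ :=
  (Finset.Icc 1 (n - 1)).filter (fun i => pval π (i + 1) + r ≤ pval π i)

/-- The `r`-descent number `rdes(π)`. -/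
def rdes {n : ℕ} (r : ℕ) (π : Equiv.Perm (Fin n)) : ℕ := (rDesSet r π).card

/-- `rInv(π) = {(i,j) : i < j, π_i > π_j, π_i < π_j + r}`. -/
def rInvSet {n : ℕ} (r : ℕ) (π : Equiv.Perm (Fin n)) : Finset (ℕ × ℕ) :=
  ((Finset.Icc 1 n) ×ˢ (Finset.Icc 1 n)).filter
    (fun p => p.1 < p.2 ∧ pval π p.2 < pval π p.1 ∧ pval π p.1 < pval π p.2 + r)

/-- The `r`-major index `rmaj(π) = ∑_{i ∈ rDes(π)} i + |rInv(π)|`. -/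
def rmaj {n : ℕ} (r : ℕ) (π : Equiv.Perm (Fin n)) : ℕ :=
  (∑ i ∈ rDesSet r π, i) + (rInvSet r π).card

/-- The inversion number `inv(π)`: the number of pairs `i < j` with `π_i > π_j`. -/
def invStat {n : ℕ} (π : Equiv.Perm (Fin n)) : ℕ :=
  (((Finset.Icc 1 n) ×ˢ (Finset.Icc 1 n)).filter
    (fun p => p.1 < p.2 ∧ pval π p.2 < pval π p.1)).card

/-- `Excp_r(π)`: the set of `r`-level excedance places, i.e. indices `i`
with `π_i > i` and `π_i ≥ r`. -/
def excpSet {n : ℕ} (r : ℕ) (π : Equiv.Perm (Fin n)) : Finset ℕ :=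
  (Finset.Icc 1 n).filter (fun i => i < pval π i ∧ r ≤ pval π i)

/-- `Exc_r(π)`: the subword of `π` on the `r`-level excedance places,
in increasing order of position. -/
def excWord {n : ℕ} (r : ℕ) (π : Equiv.Perm (Fin n)) : List ℕ :=
  ((excpSet r π).sort (· ≤ ·)).map (pval π)

/-- `Nexc_r(π)`: the subword of `π` on the non-`r`-level-excedance places,
in increasing order of position. -/
def nexcWord {n : ℕ} (r : ℕ) (π : Equiv.Perm (Fin n)) : List ℕ :=
  (((Finset.Icc 1 n) \ excpSet r π).sort (· ≤ ·)).map (pval π)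

/-- The `r`-level Denert statistic
`den_r(π) = ∑_{i ∈ Excp_r(π)} i + inv(Exc_r(π)) + inv(Nexc_r(π))`. -/
def denr {n : ℕ} (r : ℕ) (π : Equiv.Perm (Fin n)) : ℕ :=
  (∑ i ∈ excpSet r π, i) + winv (excWord r π) + winv (nexcWord r π)

/-- The `r`-level excedance number `exc_r(π) = |{i : π_i > i ≥ r}|`. -/
def excr {n : ℕ} (r : ℕ) (π : Equiv.Perm (Fin n)) : ℕ :=
  ((Finset.Icc 1 n).filter (fun i => r ≤ i ∧ i < pval π i)).card

/-- The set of excedance places of `π`: indices `i` with `π_i > i`. -/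
def excpSet' {n : ℕ} (π : Equiv.Perm (Fin n)) : Finset ℕ :=
  (Finset.Icc 1 n).filter (fun i => i < pval π i)

/-- The excedance number `exc(π)`. -/
def excStat {n : ℕ} (π : Equiv.Perm (Fin n)) : ℕ := (excpSet' π).card

/-- `Exc(π)`: the subword of `π` on the excedance places. -/
def excWord' {n : ℕ} (π : Equiv.Perm (Fin n)) : List ℕ :=
  ((excpSet' π).sort (· ≤ ·)).map (pval π)

/-- `Nexc(π)`: the subword of `π` on the non-excedance places. -/
def nexcWord' {n : ℕ} (π : Equiv.Perm (Fin n)) : List ℕ :=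
  (((Finset.Icc 1 n) \ excpSet' π).sort (· ≤ ·)).map (pval π)

/-- Denert's statistic `den(π)`. -/
def denStat {n : ℕ} (π : Equiv.Perm (Fin n)) : ℕ :=
  (∑ i ∈ excpSet' π, i) + winv (excWord' π) + winv (nexcWord' π)

lemma sum_Icc_one_eq_sum_fin (n : ℕ) (g : ℕ → ℕ) :
    ∑ i ∈ Icc 1 n, g i = ∑ i : Fin n, g (i + 1) := by
  rw [Fin.sum_univ_eq_sum_range (fun i => g (i + 1)), Finset.range_eq_Ico,
    Finset.sum_Ico_add' g 0 n 1]
  rfl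

lemma pval_add_one {n : ℕ} (π : Equiv.Perm (Fin n)) (i : Fin n) :
    pval π (i + 1) = π i + 1 := by
  have := i.isLt
  rw [pval, dif_pos (by omega)]
  simp

lemma winv_map_sort (S : Finset ℕ) (f : ℕ → ℕ) :
    winv ((S.sort (· ≤ ·)).map f) = ∑ i ∈ S, ∑ j ∈ S, if i < j ∧ f j < f i then 1 else 0 := by
  rw [← Finset.sum_product' S S (fun i j => if i < j ∧ f j < f i then 1 else 0),
    ← Finset.card_filter, winv]
  set l := S.sort (· ≤ ·) with hl
  have hmono : StrictMono l.get := (Finset.sortedLT_sort S).strictMono_get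
  have hmem : ∀ a, a ∈ l ↔ a ∈ S := fun a => Finset.mem_sort _
  have hget : ∀ (a : ℕ) (ha : a < l.length), l.getD a 0 = l.get ⟨a, ha⟩ := by
    intro a ha; simp [ha]
  have hmap : ∀ a, a < l.length → (l.map f).getD a 0 = f (l.getD a 0) := by
    intro a ha; simp [ha]
  have hlt : ∀ a b, a < l.length → b < l.length → (l.getD a 0 < l.getD b 0 ↔ a < b) := by
    intro a b ha hb
    rw [hget a ha, hget b hb, hmono.lt_iff_lt, Fin.mk_lt_mk]
  refine Finset.card_bij (fun p _ => (l.getD p.1 0, l.getD p.2 0)) ?_ ?_ ?_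
  · rintro ⟨a, b⟩ h
    simp only [mem_filter, mem_product, mem_range, List.length_map] at h ⊢
    obtain ⟨⟨ha, hb⟩, hab, hf⟩ := h
    rw [hmap a ha, hmap b hb] at hf
    refine ⟨⟨?_, ?_⟩, (hlt a b ha hb).2 hab, hf⟩
    · rw [← hmem, hget a ha]; exact List.get_mem _ _
    · rw [← hmem, hget b hb]; exact List.get_mem _ _
  · rintro ⟨a, b⟩ h ⟨a', b'⟩ h' heq
    simp only [mem_filter, mem_product, mem_range, List.length_map] at h h'
    obtain ⟨⟨ha, hb⟩, -⟩ := h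
    obtain ⟨⟨ha', hb'⟩, -⟩ := h'
    simp only [Prod.mk.injEq] at heq ⊢
    have h1 := hlt a a' ha ha'
    have h2 := hlt a' a ha' ha
    have h3 := hlt b b' hb hb'
    have h4 := hlt b' b hb' hb
    omega
  · rintro ⟨u, v⟩ h
    simp only [mem_filter, mem_product] at h
    obtain ⟨⟨hu, hv⟩, huv, hf⟩ := h
    obtain ⟨a, rfl⟩ := List.get_of_mem ((hmem u).2 hu)
    obtain ⟨b, rfl⟩ := List.get_of_mem ((hmem v).2 hv)
    have ea := hget a a.isLt
    have eb := hget b b.isLt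
    refine ⟨(a, b), ?_, by simp only [ea, eb]⟩
    simp only [mem_filter, mem_product, mem_range, List.length_map]
    refine ⟨⟨a.isLt, b.isLt⟩, hmono.lt_iff_lt.1 huv, ?_⟩
    rw [hmap a a.isLt, hmap b b.isLt, ea, eb]
    exact hf

/-- The inversions counted by `denStat`: both positions are excedance places, or neither is. -/
def IsDenInv {n : ℕ} (σ : Fin n → Fin n) (i j : Fin n) : Prop :=
  i < j ∧ (i < σ i ↔ j < σ j) ∧ σ j < σ i

instance {n : ℕ} (σ : Fin n → Fin n) (i j : Fin n) : Decidable (IsDenInv σ i j) :=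
  inferInstanceAs (Decidable (_ ∧ _))

lemma excStat_eq_sum {n : ℕ} (π : Equiv.Perm (Fin n)) :
    excStat π = ∑ i, if i < π i then 1 else 0 := by
  rw [excStat, excpSet', card_filter, sum_Icc_one_eq_sum_fin]
  simp [pval_add_one]

lemma denStat_eq_sum {n : ℕ} (π : Equiv.Perm (Fin n)) :
    denStat π = (∑ i, if i < π i then (i : ℕ) + 1 else 0)
      + ∑ i, ∑ j, if IsDenInv π i j then 1 else 0 := by
  rw [denStat, excWord', nexcWord', winv_map_sort, winv_map_sort, add_assoc, excpSet',
    ← filter_not]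
  simp only [sum_filter, sum_Icc_one_eq_sum_fin, pval_add_one, add_lt_add_iff_right,
    Fin.val_fin_lt]
  congr 1
  rw [← sum_add_distrib]
  refine sum_congr rfl fun i _ => ?_
  by_cases h : i < π i
  · simp only [h, if_true, not_true, if_false, add_zero]
    refine sum_congr rfl fun j _ => ?_
    by_cases hj : j < π j <;> simp [h, hj, IsDenInv]
  · simp only [h, if_true, not_false_iff, if_false, zero_add]
    refine sum_congr rfl fun j _ => ?_
    by_cases hj : j < π j <;> simp [h, hj, IsDenInv]

/-- The least element of `E ∪ {m}` that is at least `t` (for `t ≤ m`). -/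
noncomputable def nextLetter (E : Finset ℕ) (m t : ℕ) : ℕ :=
  sInf {w | (w ∈ E ∨ w = m) ∧ t ≤ w}

/-- Replaces each letter of `E` that is at least `x` by the following element of `E ∪ {m}`. -/
noncomputable def raise (E : Finset ℕ) (m x v : ℕ) : ℕ :=
  if v ∈ E ∧ x ≤ v then nextLetter E m (v + 1) else v

/-- The amount by which `den` grows when a letter is inserted at position `x` into a permutation
with set of excedance letters `E`. -/
def denIncrement (E : Finset ℕ) (m x : ℕ) : ℕ :=
  (E.filter (x ≤ ·)).card + if x ∈ E ∨ x = m then 0 else x + 1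

lemma nextLetter_spec (E : Finset ℕ) {m t : ℕ} (ht : t ≤ m) :
    (nextLetter E m t ∈ E ∨ nextLetter E m t = m) ∧ t ≤ nextLetter E m t :=
  Nat.sInf_mem (s := {w | (w ∈ E ∨ w = m) ∧ t ≤ w}) ⟨m, Or.inr rfl, ht⟩

lemma nextLetter_le {E : Finset ℕ} {m t w : ℕ} (hw : w ∈ E ∨ w = m) (htw : t ≤ w) :
    nextLetter E m t ≤ w :=
  Nat.sInf_le ⟨hw, htw⟩

lemma raise_of_notMem {E : Finset ℕ} {m x v : ℕ} (hv : v ∉ E) : raise E m x v = v :=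
  if_neg fun h => hv h.1

lemma raise_of_lt {E : Finset ℕ} {m x v : ℕ} (hv : v < x) : raise E m x v = v :=
  if_neg fun h => by omega

lemma raise_of_mem {E : Finset ℕ} {m x v : ℕ} (hv : v ∈ E) (hx : x ≤ v) :
    raise E m x v = nextLetter E m (v + 1) :=
  if_pos ⟨hv, hx⟩

lemma nextLetter_mem_Icc (E : Finset ℕ) {m t : ℕ} (ht : t ≤ m) : nextLetter E m t ∈ Set.Icc t m :=
  ⟨(nextLetter_spec E ht).2, nextLetter_le (Or.inr rfl) ht⟩

lemma denIncrement_le_iff (E : Finset ℕ) (m x : ℕ) :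
    denIncrement E m x ≤ E.card ↔ x ∈ E ∨ x = m := by
  have hcard := card_filter_add_card_filter_not (s := E) (x ≤ ·)
  have hle : (E.filter (¬ x ≤ ·)).card ≤ x := by
    calc _ ≤ (range x).card := card_le_card fun v hv => by simp at hv ⊢; omega
      _ = x := card_range x
  rw [denIncrement]
  split_ifs with h
  · exact iff_of_true (by omega) h
  · exact iff_of_false (by omega) h

lemma raise_le (E : Finset ℕ) {m x v : ℕ} (hv : v < m) : raise E m x v ≤ m := by
  rw [raise]
  split_ifs
  · exact (nextLetter_mem_Icc E hv).2
  · exact hv.le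

lemma denIncrement_injOn (E : Finset ℕ) (m : ℕ) : Set.InjOn (denIncrement E m) (Set.Iic m) := by
  have key : ∀ x y, x < y → y ≤ m → denIncrement E m x ≠ denIncrement E m y := by
    intro x y hxy hy heq
    have hx : x < m := by omega
    have hiff := (denIncrement_le_iff E m x).symm.trans
      (heq ▸ denIncrement_le_iff E m y)
    have hsplit : (E.filter (x ≤ ·)).card
        = (E.filter (y ≤ ·)).card + (E.filter (fun v => x ≤ v ∧ v < y)).card := by
      rw [← card_union_of_disjoint]
      · congr 1
        ext v
        simp only [mem_union, mem_filter]
        constructor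
        · rintro ⟨h, h'⟩
          by_cases hv : y ≤ v
          · exact Or.inl ⟨h, hv⟩
          · exact Or.inr ⟨h, h', by omega⟩
        · rintro (⟨h, h'⟩ | ⟨h, h', -⟩)
          · exact ⟨h, by omega⟩
          · exact ⟨h, h'⟩
      · rw [disjoint_left]
        intro v hv hv'
        rw [mem_filter] at hv hv'
        omega
    rw [denIncrement, denIncrement] at heq
    by_cases h : x ∈ E ∨ x = m
    · rw [if_pos h, if_pos (hiff.1 h)] at heq
      have : 0 < (E.filter (fun v => x ≤ v ∧ v < y)).card :=
        card_pos.2 ⟨x, mem_filter.2 ⟨h.resolve_right hx.ne, le_rfl, hxy⟩⟩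
      omega
    · rw [if_neg h, if_neg (hiff.not.1 h)] at heq
      have : (E.filter (fun v => x ≤ v ∧ v < y)).card ≤ (Ico (x + 1) y).card :=
        card_le_card fun v hv => by
          rw [mem_filter] at hv
          have : v ≠ x := fun hvx => h (Or.inl (hvx ▸ hv.1))
          rw [mem_Ico]; omega
      rw [Nat.card_Ico] at this
      omega
  intro x hx y hy heq
  rcases lt_trichotomy x y with h | h | h
  · exact absurd heq (key x y h hy)
  · exact h
  · exact absurd heq.symm (key y x h hx)

section Letters

variable {E : Finset ℕ} {m : ℕ} (hE : ∀ v ∈ E, v < m)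
include hE

lemma nextLetter_eq_self {t : ℕ} (ht : t ∈ E ∨ t = m) : nextLetter E m t = t :=
  (nextLetter_le ht le_rfl).antisymm
    (nextLetter_spec E (ht.elim (fun h => (hE t h).le) le_of_eq)).2

lemma lt_raise {x v : ℕ} (hv : v ∈ E) (hx : x ≤ v) : v < raise E m x v := by
  rw [raise_of_mem hv hx]
  exact (nextLetter_mem_Icc E (hE v hv)).1

lemma le_raise (x v : ℕ) : v ≤ raise E m x v := by
  by_cases h : v ∈ E ∧ x ≤ v
  · exact (lt_raise hE h.1 h.2).le
  · rw [raise, if_neg h]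

lemma raise_mem {x v : ℕ} (hv : v ∈ E) : raise E m x v ∈ E ∨ raise E m x v = m := by
  rw [raise]
  split_ifs
  · exact (nextLetter_spec E (hE v hv)).1
  · exact Or.inl hv

lemma raise_lt_raise {x v w : ℕ} (hw : w ∈ E) (hvw : v < w) :
    raise E m x v < raise E m x w := by
  by_cases h : v ∈ E ∧ x ≤ v
  · rw [raise_of_mem h.1 h.2]
    exact (nextLetter_le (Or.inl hw) hvw).trans_lt (lt_raise hE hw (by omega))
  · rw [raise, if_neg h]
    exact hvw.trans_le (le_raise hE x w)

lemma raise_lt_raise_iff {x v w : ℕ} (h : v ∈ E ↔ w ∈ E) :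
    raise E m x v < raise E m x w ↔ v < w := by
  by_cases hw : w ∈ E
  · rcases lt_trichotomy v w with hlt | rfl | hlt
    · exact iff_of_true (raise_lt_raise hE hw hlt) hlt
    · simp
    · exact iff_of_false (raise_lt_raise hE (h.2 hw) hlt).not_gt hlt.not_gt
  · rw [raise_of_notMem hw, raise_of_notMem (h.not.2 hw)]

lemma raise_injOn (x : ℕ) : Set.InjOn (raise E m x) (Set.Iio m) := by
  have key : ∀ v w, w < m → v ∈ E → w ∉ E → raise E m x v ≠ raise E m x w := by
    intro v w hwm hv hw heq
    rw [raise_of_notMem hw] at heq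
    rcases raise_mem hE (x := x) hv with h | h
    · exact hw (heq ▸ h)
    · omega
  intro v hv w hw heq
  by_cases h : v ∈ E ↔ w ∈ E
  · have h1 := raise_lt_raise_iff hE (x := x) h
    have h2 := raise_lt_raise_iff hE (x := x) h.symm
    simp only [heq, lt_irrefl, false_iff] at h1 h2
    omega
  · by_cases hvE : v ∈ E
    · exact absurd heq (key v w hw hvE fun hwE => h (iff_of_true hvE hwE))
    · exact absurd heq.symm (key w v hv (by tauto) hvE)

lemma nextLetter_ne_raise {x v : ℕ} (hx : x ≤ m) (hv : v < m) :
    nextLetter E m x ≠ raise E m x v := by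
  have hs := nextLetter_spec E hx
  intro heq
  by_cases h : v ∈ E
  · by_cases hxv : x ≤ v
    · have h1 := lt_raise hE h hxv
      have h2 := nextLetter_le (m := m) (Or.inl h) hxv
      omega
    · rw [raise_of_lt (by omega)] at heq
      omega
  · rw [raise_of_notMem h] at heq
    rcases hs.1 with h' | h'
    · exact h (heq ▸ h')
    · omega

lemma nextLetter_lt_raise_iff {x v : ℕ} (hx : x ≤ m) (hv : v ∈ E) :
    nextLetter E m x < raise E m x v ↔ x ≤ v := by
  by_cases hxv : x ≤ v
  · exact iff_of_true ((nextLetter_le (Or.inl hv) hxv).trans_lt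
      (lt_raise hE hv hxv)) hxv
  · have := (nextLetter_mem_Icc E hx).1
    rw [raise_of_lt (by omega)]
    omega

lemma denIncrement_le {x : ℕ} (hx : x ≤ m) : denIncrement E m x ≤ m := by
  have hEm : E ⊆ range m := fun v hv => mem_range.2 (hE v hv)
  by_cases h : x ∈ E ∨ x = m
  · calc _ ≤ E.card := (denIncrement_le_iff E m x).2 h
      _ ≤ (range m).card := card_le_card hEm
      _ = m := card_range m
  · have hxm : x < m := by omega
    have : (E.filter (x ≤ ·)).card ≤ (Ico (x + 1) m).card := card_le_card fun v hv => by
      rw [mem_filter] at hv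
      have : v ≠ x := fun hvx => h (Or.inl (hvx ▸ hv.1))
      have := hE v hv.1
      rw [mem_Ico]; omega
    rw [denIncrement, if_neg h]
    rw [Nat.card_Ico] at this
    omega

end Letters

section Insertion

variable {m : ℕ}

/-- The set of excedance letters of `π`, as `0`-based values. -/
def excLetters (π : Equiv.Perm (Fin m)) : Finset ℕ :=
  (univ.filter fun i => i < π i).image fun i => (π i : ℕ)

lemma mem_excLetters {π : Equiv.Perm (Fin m)} {i : Fin m} :
    (π i : ℕ) ∈ excLetters π ↔ i < π i := by
  simp only [excLetters, mem_image, mem_filter, mem_univ, true_and]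
  constructor
  · rintro ⟨j, hj, heq⟩
    rwa [← π.injective (Fin.ext heq)]
  · exact fun h => ⟨i, h, rfl⟩

lemma exists_of_mem_excLetters {π : Equiv.Perm (Fin m)} {v : ℕ} (hv : v ∈ excLetters π) :
    ∃ i, i < π i ∧ (π i : ℕ) = v := by
  simpa [excLetters] using hv

lemma lt_of_mem_excLetters (π : Equiv.Perm (Fin m)) : ∀ v ∈ excLetters π, v < m := by
  intro v hv
  obtain ⟨i, -, rfl⟩ := exists_of_mem_excLetters hv
  exact (π i).isLt

lemma card_image_val_perm (π : Equiv.Perm (Fin m)) (s : Finset (Fin m)) :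
    (s.image fun i => (π i : ℕ)).card = s.card :=
  card_image_of_injective _ (Fin.val_injective.comp π.injective)

lemma card_filter_excLetters (π : Equiv.Perm (Fin m)) (x : ℕ) :
    ((excLetters π).filter (x ≤ ·)).card = ∑ i, if i < π i ∧ x ≤ π i then 1 else 0 := by
  rw [excLetters, filter_image, card_image_val_perm,
    filter_filter, card_filter]

lemma card_excLetters (π : Equiv.Perm (Fin m)) : (excLetters π).card = excStat π := by
  rw [excLetters, card_image_val_perm, card_filter,
    excStat_eq_sum]

/-- The letters of `insertPerm π x`. -/
noncomputable def insertFun (π : Equiv.Perm (Fin m)) (x : Fin (m + 1)) :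
    Fin (m + 1) → Fin (m + 1) :=
  x.insertNth (α := fun _ => Fin (m + 1))
    ⟨nextLetter (excLetters π) m x, Nat.lt_succ_of_le (nextLetter_mem_Icc _ x.is_le).2⟩
    fun i => ⟨raise (excLetters π) m x (π i),
      Nat.lt_succ_of_le (raise_le _ (π i).isLt)⟩

lemma insertFun_injective (π : Equiv.Perm (Fin m)) (x : Fin (m + 1)) :
    Function.Injective (insertFun π x) := by
  have hE := lt_of_mem_excLetters π
  have hne : ∀ i, insertFun π x x ≠ insertFun π x (x.succAbove i) := by
    intro i h
    simp only [insertFun, Fin.insertNth_apply_same, Fin.insertNth_apply_succAbove,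
      Fin.mk.injEq] at h
    exact nextLetter_ne_raise hE x.is_le (π i).isLt h
  intro p q
  induction p using Fin.succAboveCases x with
  | x =>
    induction q using Fin.succAboveCases x with
    | x => simp
    | p j => exact fun h => absurd h (hne j)
  | p i =>
    induction q using Fin.succAboveCases x with
    | x => exact fun h => absurd h.symm (hne i)
    | p j =>
      intro h
      simp only [insertFun, Fin.insertNth_apply_succAbove, Fin.mk.injEq] at h
      rw [π.injective (Fin.ext (raise_injOn hE x (π i).isLt (π j).isLt h))]

/-- Insert a new position `x` into `π`: the new letter is the least element `e ≥ x` of the set of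
excedance letters of `π` enlarged by the new largest letter, and each excedance letter that is at
least `e` is replaced by the following element of that set. -/
noncomputable def insertPerm (π : Equiv.Perm (Fin m)) (x : Fin (m + 1)) :
    Equiv.Perm (Fin (m + 1)) :=
  Equiv.ofBijective (insertFun π x) (Finite.injective_iff_bijective.1 (insertFun_injective π x))

lemma insertPerm_same (π : Equiv.Perm (Fin m)) (x : Fin (m + 1)) :
    (insertPerm π x x : ℕ) = nextLetter (excLetters π) m x := by
  simp [insertPerm, insertFun]

lemma insertPerm_succAbove (π : Equiv.Perm (Fin m)) (x : Fin (m + 1)) (i : Fin m) :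
    (insertPerm π x (x.succAbove i) : ℕ) = raise (excLetters π) m x (π i) := by
  simp [insertPerm, insertFun]

lemma val_succAbove (x : Fin (m + 1)) (i : Fin m) :
    (x.succAbove i : ℕ) = if (i : ℕ) < x then (i : ℕ) else i + 1 := by
  rw [Fin.succAbove, apply_ite Fin.val]
  rfl

lemma lt_insertPerm_same_iff (π : Equiv.Perm (Fin m)) (x : Fin (m + 1)) :
    x < insertPerm π x x ↔ ¬ ((x : ℕ) ∈ excLetters π ∨ (x : ℕ) = m) := by
  rw [Fin.lt_def, insertPerm_same]
  have hs := nextLetter_spec (excLetters π) x.is_le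
  constructor
  · intro h h'
    rw [nextLetter_eq_self (lt_of_mem_excLetters π) h'] at h
    exact h.false
  · intro h
    refine lt_of_le_of_ne hs.2 fun heq => h ?_
    rw [← heq] at hs
    exact hs.1

lemma lt_insertPerm_succAbove_iff (π : Equiv.Perm (Fin m)) (x : Fin (m + 1)) (i : Fin m) :
    x.succAbove i < insertPerm π x (x.succAbove i) ↔ i < π i := by
  have hE := lt_of_mem_excLetters π
  rw [Fin.lt_def, insertPerm_succAbove, val_succAbove]
  by_cases h : i < π i
  · refine iff_of_true ?_ h
    by_cases hx : (x : ℕ) ≤ π i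
    · have := lt_raise hE (mem_excLetters.2 h) hx
      split_ifs <;> omega
    · rw [raise_of_lt (by omega), if_pos (by omega)]
      exact h
  · rw [raise_of_notMem (mem_excLetters.not.2 h)]
    split_ifs <;> omega

lemma excStat_insertPerm (π : Equiv.Perm (Fin m)) (x : Fin (m + 1)) :
    excStat (insertPerm π x)
      = excStat π + if (x : ℕ) ∈ excLetters π ∨ (x : ℕ) = m then 0 else 1 := by
  rw [excStat_eq_sum, excStat_eq_sum, Fin.sum_univ_succAbove _ x, add_comm]
  simp only [lt_insertPerm_succAbove_iff, lt_insertPerm_same_iff, ite_not]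

lemma isDenInv_insertPerm_succAbove (π : Equiv.Perm (Fin m)) (x : Fin (m + 1)) (i j : Fin m) :
    IsDenInv (insertPerm π x) (x.succAbove i) (x.succAbove j) ↔ IsDenInv π i j := by
  rw [IsDenInv, IsDenInv, lt_insertPerm_succAbove_iff, lt_insertPerm_succAbove_iff,
    (Fin.strictMono_succAbove x).lt_iff_lt, Fin.lt_def (a := insertPerm π x _),
    insertPerm_succAbove, insertPerm_succAbove]
  refine and_congr_right fun _ => and_congr_right fun h => ?_
  exact raise_lt_raise_iff (lt_of_mem_excLetters π)
    (mem_excLetters.trans (h.symm.trans mem_excLetters.symm))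

/-- The values below `x` at positions at least `x` are as many as the values at least `x` at
positions below `x`. -/
lemma sum_crossing (π : Equiv.Perm (Fin m)) (x : ℕ) :
    (∑ i : Fin m, if x ≤ i ∧ (π i : ℕ) < x then 1 else 0)
      = ∑ i : Fin m, if (i : ℕ) < x ∧ x ≤ π i then 1 else 0 := by
  have h := Equiv.sum_comp π fun i : Fin m => if (i : ℕ) < x then 1 else 0
  have h' : (∑ i : Fin m, if (π i : ℕ) < x then 1 else 0)
        + (∑ i : Fin m, if (i : ℕ) < x ∧ x ≤ π i then 1 else 0)
      = (∑ i : Fin m, if (i : ℕ) < x then 1 else 0)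
        + ∑ i : Fin m, if x ≤ i ∧ (π i : ℕ) < x then 1 else 0 := by
    rw [← sum_add_distrib, ← sum_add_distrib]
    refine sum_congr rfl fun i _ => ?_
    split_ifs <;> omega
  omega

lemma sum_isDenInv_insertPerm_same (π : Equiv.Perm (Fin m)) (x : Fin (m + 1)) :
    (∑ j, if IsDenInv (insertPerm π x) x (x.succAbove j) then 1 else 0)
      + (∑ i, if IsDenInv (insertPerm π x) (x.succAbove i) x then 1 else 0)
      = ∑ i : Fin m, if (i : ℕ) < x ∧ (x : ℕ) ≤ π i then 1 else 0 := by
  have hE := lt_of_mem_excLetters π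
  have hx := (nextLetter_mem_Icc (excLetters π) x.is_le).1
  by_cases h : (x : ℕ) ∈ excLetters π ∨ (x : ℕ) = m
  · have h2 : ∀ i, ¬ IsDenInv (insertPerm π x) (x.succAbove i) x := by
      rintro i ⟨h1, h2, h3⟩
      rw [lt_insertPerm_succAbove_iff, lt_insertPerm_same_iff] at h2
      have hi : ¬ i < π i := fun hi => h2.1 hi h
      rw [Fin.lt_def, insertPerm_same, insertPerm_succAbove,
        raise_of_notMem (mem_excLetters.not.2 hi)] at h3
      rw [Fin.lt_def, val_succAbove] at h1
      split_ifs at h1 <;> omega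
    have h1 : ∀ j, IsDenInv (insertPerm π x) x (x.succAbove j)
        ↔ (x : ℕ) ≤ j ∧ (π j : ℕ) < x := by
      intro j
      rw [IsDenInv, lt_insertPerm_succAbove_iff, lt_insertPerm_same_iff, Fin.lt_def,
        Fin.lt_def (a := insertPerm π x _), insertPerm_same, insertPerm_succAbove,
        nextLetter_eq_self hE h, val_succAbove]
      have := le_raise hE x (π j)
      constructor
      · rintro ⟨h1, -, h3⟩
        refine ⟨?_, by omega⟩
        split_ifs at h1 <;> omega
      · rintro ⟨h1, h3⟩
        rw [if_neg (by omega), raise_of_lt h3]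
        refine ⟨by omega, iff_of_false (not_not.2 h) (by omega), h3⟩
    simp only [h1, h2, if_false, sum_const_zero, add_zero, sum_crossing]
  · have h1 : ∀ j, ¬ IsDenInv (insertPerm π x) x (x.succAbove j) := by
      rintro j ⟨h1, h2, h3⟩
      rw [lt_insertPerm_succAbove_iff, lt_insertPerm_same_iff] at h2
      have hj := h2.1 h
      rw [Fin.lt_def, insertPerm_same, insertPerm_succAbove] at h3
      rw [Fin.lt_def, val_succAbove] at h1
      have := nextLetter_lt_raise_iff hE x.is_le (mem_excLetters.2 hj)
      split_ifs at h1 <;> omega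
    have h2 : ∀ i, IsDenInv (insertPerm π x) (x.succAbove i) x
        ↔ (i : ℕ) < x ∧ (x : ℕ) ≤ π i := by
      intro i
      rw [IsDenInv, lt_insertPerm_succAbove_iff, lt_insertPerm_same_iff, Fin.lt_def,
        Fin.lt_def (a := insertPerm π x _), insertPerm_same, insertPerm_succAbove, val_succAbove]
      constructor
      · rintro ⟨h1, h2, h3⟩
        refine ⟨by split_ifs at h1 <;> omega, ?_⟩
        exact (nextLetter_lt_raise_iff hE x.is_le (mem_excLetters.2 (h2.2 h))).1 h3
      · rintro ⟨h1, h3⟩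
        have hi : i < π i := by omega
        rw [if_pos h1]
        exact ⟨h1, iff_of_true hi h,
          (nextLetter_lt_raise_iff hE x.is_le (mem_excLetters.2 hi)).2 h3⟩
    simp only [h1, h2, if_false, sum_const_zero, zero_add]

lemma denStat_insertPerm (π : Equiv.Perm (Fin m)) (x : Fin (m + 1)) :
    denStat (insertPerm π x) = denStat π + denIncrement (excLetters π) m x := by
  have hxx : ¬ IsDenInv (insertPerm π x) x x := fun h => h.1.false
  have hplaces : (∑ i, if i < π i then (x.succAbove i : ℕ) + 1 else 0)
      = (∑ i, if i < π i then (i : ℕ) + 1 else 0)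
        + ∑ i, if i < π i ∧ (x : ℕ) ≤ i then 1 else 0 := by
    rw [← sum_add_distrib]
    refine sum_congr rfl fun i _ => ?_
    rw [val_succAbove]
    split_ifs <;> omega
  have hcard : ((excLetters π).filter ((x : ℕ) ≤ ·)).card
      = (∑ i, if i < π i ∧ (x : ℕ) ≤ i then 1 else 0)
        + ∑ i : Fin m, if (i : ℕ) < x ∧ (x : ℕ) ≤ π i then 1 else 0 := by
    rw [card_filter_excLetters, ← sum_add_distrib]
    refine sum_congr rfl fun i _ => ?_
    split_ifs <;> omega
  have hnew := sum_isDenInv_insertPerm_same π x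
  rw [denStat_eq_sum, denStat_eq_sum, Fin.sum_univ_succAbove _ x, Fin.sum_univ_succAbove _ x]
  simp only [Fin.sum_univ_succAbove _ x, lt_insertPerm_succAbove_iff, lt_insertPerm_same_iff,
    isDenInv_insertPerm_succAbove, sum_add_distrib, hplaces, if_neg hxx, ite_not]
  rw [denIncrement, hcard]
  omega

/-- No excedance letter of `σ` lies in `[y, σ y)`. -/
def IsGap {n : ℕ} (σ : Equiv.Perm (Fin n)) (y : Fin n) : Prop :=
  y ≤ σ y ∧ ∀ j, j < σ j → y ≤ σ j → σ y ≤ σ j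

lemma isGap_insertPerm (π : Equiv.Perm (Fin m)) (x : Fin (m + 1)) :
    IsGap (insertPerm π x) x := by
  have hE := lt_of_mem_excLetters π
  have hx := (nextLetter_mem_Icc (excLetters π) x.is_le).1
  refine ⟨by rwa [Fin.le_def, insertPerm_same], fun j => ?_⟩
  induction j using Fin.succAboveCases x with
  | x => simp
  | p i =>
    rw [lt_insertPerm_succAbove_iff, Fin.le_def, Fin.le_def, insertPerm_same,
      insertPerm_succAbove]
    exact fun hi h => nextLetter_le (raise_mem hE (mem_excLetters.2 hi)) h

lemma le_of_isGap_insertPerm {π : Equiv.Perm (Fin m)} {x y : Fin (m + 1)}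
    (h : IsGap (insertPerm π x) y) : y ≤ x := by
  have hE := lt_of_mem_excLetters π
  have hx := nextLetter_mem_Icc (excLetters π) x.is_le
  induction y using Fin.succAboveCases x with
  | x => exact le_rfl
  | p i =>
    obtain ⟨h1, h2⟩ := h
    by_contra hlt
    rw [not_le, Fin.lt_def, val_succAbove] at hlt
    have hxi : (x : ℕ) ≤ i := by split_ifs at hlt <;> omega
    rw [Fin.le_def, insertPerm_succAbove, val_succAbove, if_neg (by omega)] at h1
    by_cases hi : i < π i
    · have hπ : (i : ℕ) < π i := hi
      have hv := mem_excLetters.2 hi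
      have hr := lt_raise hE hv (by omega : (x : ℕ) ≤ π i)
      obtain ⟨j, hj⟩ := (insertPerm π x).surjective (π i).castSucc
      have hj' := congrArg Fin.val hj
      rw [Fin.val_castSucc] at hj'
      have hexc : j < insertPerm π x j := by
        induction j using Fin.succAboveCases x with
        | x =>
          rw [Fin.lt_def, hj']
          omega
        | p k =>
          rw [lt_insertPerm_succAbove_iff, ← mem_excLetters]
          by_contra hk
          rw [insertPerm_succAbove, raise_of_notMem hk] at hj'
          exact hk (hj' ▸ hv)
      have := h2 j hexc
      rw [Fin.le_def, Fin.le_def, hj', insertPerm_succAbove, val_succAbove,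
        if_neg (by omega)] at this
      omega
    · rw [raise_of_notMem (mem_excLetters.not.2 hi)] at h1
      omega

lemma mem_excLetters_iff {π : Equiv.Perm (Fin m)} {v : ℕ} :
    v ∈ excLetters π ↔ v < m ∧ ∀ i, ¬ i < π i → (π i : ℕ) ≠ v := by
  constructor
  · intro hv
    refine ⟨lt_of_mem_excLetters π v hv, ?_⟩
    rintro i hi rfl
    exact hi (mem_excLetters.1 hv)
  · rintro ⟨hv, h⟩
    obtain ⟨i, hi⟩ := π.surjective ⟨v, hv⟩
    have hi' : (π i : ℕ) = v := congrArg Fin.val hi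
    rw [← hi', mem_excLetters]
    by_contra hlt
    exact h i hlt hi'

lemma insertPerm_injective (x : Fin (m + 1)) :
    Function.Injective fun π : Equiv.Perm (Fin m) => insertPerm π x := by
  intro π ρ h
  have hval : ∀ i, raise (excLetters π) m x (π i) = raise (excLetters ρ) m x (ρ i) := by
    intro i
    rw [← insertPerm_succAbove, ← insertPerm_succAbove]
    exact congrArg (fun σ : Equiv.Perm (Fin (m + 1)) => (σ (x.succAbove i) : ℕ)) h
  have hexc : ∀ i, i < π i ↔ i < ρ i := by
    intro i
    rw [← lt_insertPerm_succAbove_iff π x, ← lt_insertPerm_succAbove_iff ρ x]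
    exact iff_of_eq
      (congrArg (fun σ : Equiv.Perm (Fin (m + 1)) => x.succAbove i < σ (x.succAbove i)) h)
  have hnexc : ∀ i, ¬ i < π i → (π i : ℕ) = ρ i := by
    intro i hi
    have := hval i
    rwa [raise_of_notMem (mem_excLetters.not.2 hi),
      raise_of_notMem (mem_excLetters.not.2 ((hexc i).not.1 hi))] at this
  have hE : excLetters π = excLetters ρ := by
    ext v
    rw [mem_excLetters_iff, mem_excLetters_iff]
    refine and_congr_right fun _ => forall_congr' fun i => ?_
    rw [← hexc i]
    exact forall_congr' fun hi => by rw [hnexc i hi]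
  ext i
  refine raise_injOn (lt_of_mem_excLetters π) x (π i).isLt (ρ i).isLt ?_
  rw [hval i, hE]

lemma insertPerm_uncurry_injective :
    Function.Injective fun p : Equiv.Perm (Fin m) × Fin (m + 1) => insertPerm p.1 p.2 := by
  rintro ⟨π, x⟩ ⟨ρ, y⟩ h
  change insertPerm π x = insertPerm ρ y at h
  have hxy : x = y := le_antisymm
    (le_of_isGap_insertPerm (π := ρ) (h ▸ isGap_insertPerm π x))
    (le_of_isGap_insertPerm (π := π) (h ▸ isGap_insertPerm ρ y))
  subst hxy
  rw [insertPerm_injective x h]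

/-- The positions at which a letter can be inserted into `π`, relabelled by the resulting
increment of `den`. -/
noncomputable def denIncrementEquiv (π : Equiv.Perm (Fin m)) : Equiv.Perm (Fin (m + 1)) :=
  Equiv.ofBijective
    (fun x => ⟨denIncrement (excLetters π) m x,
      Nat.lt_succ_of_le (denIncrement_le (lt_of_mem_excLetters π) x.is_le)⟩)
    (Finite.injective_iff_bijective.1 fun x y h =>
      Fin.ext (denIncrement_injOn _ m x.is_le y.is_le (congrArg Fin.val h)))

lemma denIncrement_denIncrementEquiv_symm (π : Equiv.Perm (Fin m)) (c : Fin (m + 1)) :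
    denIncrement (excLetters π) m ((denIncrementEquiv π).symm c) = c :=
  congrArg Fin.val ((denIncrementEquiv π).apply_symm_apply c)

/-- Insertion of a letter into `p.1` that increases `den` by `p.2`. -/
noncomputable def denInsert (p : Equiv.Perm (Fin m) × Fin (m + 1)) : Equiv.Perm (Fin (m + 1)) :=
  insertPerm p.1 ((denIncrementEquiv p.1).symm p.2)

lemma denInsert_bijective : Function.Bijective (denInsert (m := m)) := by
  rw [Fintype.bijective_iff_injective_and_card]
  constructor
  · rintro ⟨π, c⟩ ⟨ρ, d⟩ h
    have := insertPerm_uncurry_injective (a₁ := (π, _)) (a₂ := (ρ, _)) h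
    rw [Prod.mk.injEq] at this
    obtain ⟨rfl, hcd⟩ := this
    exact congrArg _ ((denIncrementEquiv π).symm.injective hcd)
  · rw [Fintype.card_prod, Fintype.card_perm, Fintype.card_perm, Fintype.card_fin,
      Fintype.card_fin, Nat.factorial_succ, mul_comm]

lemma denInsert_spec (π : Equiv.Perm (Fin m)) (c : Fin (m + 1)) :
    ((c : ℕ) ≤ excStat π → excStat (denInsert (π, c)) = excStat π) ∧
      (excStat π < (c : ℕ) → excStat (denInsert (π, c)) = excStat π + 1) ∧
      denStat (denInsert (π, c)) = denStat π + (c : ℕ) := by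
  have hc := denIncrement_denIncrementEquiv_symm π c
  have hle := denIncrement_le_iff (excLetters π) m ((denIncrementEquiv π).symm c)
  rw [hc, card_excLetters] at hle
  refine ⟨fun h => ?_, fun h => ?_, ?_⟩
  · rw [denInsert, excStat_insertPerm, if_pos (hle.1 h), add_zero]
  · rw [denInsert, excStat_insertPerm, if_neg (hle.not.1 h.not_ge)]
  · rw [denInsert, denStat_insertPerm, hc]

end Insertion

/-- For n ≥ 1 there is a bijection φ from S_{n-1} × {0,…,n-1}
onto S_n such that exc(φ(π,c)) = exc(π) if c ≤ exc(π) and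
exc(φ(π,c)) = exc(π) + 1 otherwise, and den(φ(π,c)) = den(π) + c. -/
theorem exists_bijection_exc_den (n : ℕ) (hn : 1 ≤ n) :
    ∃ φ : Equiv.Perm (Fin (n - 1)) × Fin n → Equiv.Perm (Fin n),
      Function.Bijective φ ∧
      ∀ (π : Equiv.Perm (Fin (n - 1))) (c : Fin n),
        ((c : ℕ) ≤ excStat π → excStat (φ (π, c)) = excStat π) ∧
        (excStat π < (c : ℕ) → excStat (φ (π, c)) = excStat π + 1) ∧
        denStat (φ (π, c)) = denStat π + (c : ℕ) := by
  obtain ⟨m, rfl⟩ : ∃ m, n = m + 1 := ⟨n - 1, by omega⟩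
  exact ⟨denInsert, denInsert_bijective, denInsert_spec⟩
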